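/- There exist x, y ∈ ℤ_{-τ} such that (-τ)·(x·y) ∉ ℤ_{-τ}; together with the bound τ²·(x·y) ∈ ℤ_{-τ} for all x, y ∈ ℤ_{-τ}, this shows L_⊗(-τ) = 2. (One may take x = y = 1 + (-τ) + (-τ)² + (-τ)³.) -/

import Mathlib

/-- The Ito–Sadahiro transformation `T_{-β}` on `[l_β, r_β)`, where
`l_β = -β/(β+1)` and `r_β = 1/(β+1)`. -/
noncomputable def negT (β : ℝ) (x : ℝ) : ℝ :=
  -β * x - (⌊-β * x - (-β / (β + 1))⌋ : ℝ)

/-- `Fin(-β)`: reals `x` such that `(-β)^k * x ∈ (l_β, r_β)` for some `k : ℤ`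
and some iterate of `T_{-β}` sends it to `0`. -/
def negFin (β : ℝ) (x : ℝ) : Prop :=
  ∃ (k : ℤ) (n : ℕ), ((-β) ^ k * x ∈ Set.Ioo (-β / (β + 1)) (1 / (β + 1))) ∧
    (negT β)^[n] ((-β) ^ k * x) = 0

/-- The set `ℤ_{-β}` of `(-β)`-integers. -/
def negInt (β : ℝ) (x : ℝ) : Prop :=
  x = 0 ∨ ∃ (N : ℕ) (y : ℝ), y ∈ Set.Ioo (-β / (β + 1)) (1 / (β + 1)) ∧
    x = (-β) ^ (N + 1) * y ∧ (negT β)^[N + 1] y = 0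

/-- The `(-β)`-digit `d_{i+1}(y)` of `y ∈ [l_β, r_β)` (indices shifted so that
`negDigit β y i` is the digit `d_{i+1}(y)`). -/
noncomputable def negDigit (β : ℝ) (y : ℝ) (i : ℕ) : ℤ :=
  ⌊-β * ((negT β)^[i] y) - (-β / (β + 1))⌋

/-- The golden ratio `τ = (1+√5)/2`. -/
noncomputable def tau : ℝ := (1 + Real.sqrt 5) / 2

/-- The Rényi transformation `T_β` on `[0,1)`. -/
noncomputable def renyiT (β : ℝ) (x : ℝ) : ℝ := β * x - (⌊β * x⌋ : ℝ)

/-- The set `ℤ_β` of (nonnegative) `β`-integers. -/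
def posInt (β : ℝ) (x : ℝ) : Prop :=
  x = 0 ∨ ∃ N : ℕ, (β ^ (-(N + 1 : ℤ)) * x ∈ Set.Ico (0 : ℝ) 1) ∧
    (renyiT β)^[N + 1] (β ^ (-(N + 1 : ℤ)) * x) = 0

lemma tau_sq : tau ^ 2 = tau + 1 := by
  have h : Real.sqrt 5 ^ 2 = 5 := Real.sq_sqrt (by norm_num)
  unfold tau
  linear_combination h / 4

lemma lt_tau : 1.618 < tau := by
  have h : (2.236 : ℝ) < Real.sqrt 5 := Real.lt_sqrt_of_sq_lt (by norm_num)
  unfold tau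
  linarith

lemma tau_lt : tau < 1.6181 := by
  have h : Real.sqrt 5 < 2.2362 := by
    rw [Real.sqrt_lt' (by norm_num)]
    norm_num
  unfold tau
  linarith

lemma neg_tau_div_tau_add_one : -tau / (tau + 1) = 1 - tau := by
  have h := lt_tau
  rw [div_eq_iff (by linarith)]
  linear_combination tau_sq

lemma one_div_tau_add_one : 1 / (tau + 1) = 2 - tau := by
  have h := lt_tau
  rw [div_eq_iff (by linarith)]
  linear_combination tau_sq

lemma negT_tau_eq {x w : ℝ} (d : ℤ) (h : -tau * x - d = w) (hl : 1 - tau ≤ w)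
    (hr : w < 2 - tau) : negT tau x = w := by
  have hd : ⌊-tau * x - (-tau / (tau + 1))⌋ = d := by
    rw [neg_tau_div_tau_add_one, Int.floor_eq_iff]
    constructor <;> linarith
  rw [negT, hd, h]

/-- Division by `-τ` is multiplication by `1 - τ`. -/
lemma eq_of_neg_tau_pow_mul_eq {k : ℕ} {y z : ℝ} (h : (-tau) ^ k * y = z) :
    y = (1 - tau) ^ k * z := by
  have h1 : (1 - tau) * -tau = 1 := by linear_combination tau_sq
  rw [← h, ← mul_assoc, ← mul_pow, h1, one_pow, one_mul]

lemma one_sub_tau_pow_two : (1 - tau) ^ 2 = 2 - tau := by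
  linear_combination tau_sq

lemma one_sub_tau_pow_four : (1 - tau) ^ 4 = 5 - 3 * tau := by
  linear_combination ((1 - tau) ^ 2 + 2 - tau) * one_sub_tau_pow_two + tau_sq

lemma one_sub_tau_pow_six_mul : (1 - tau) ^ 6 * (-5 * tau) = 40 - 25 * tau := by
  linear_combination (1 - tau) ^ 2 * (-5 * tau) * one_sub_tau_pow_four
    + (5 - 3 * tau) * (-5 * tau) * one_sub_tau_pow_two + (-15 * tau + 40) * tau_sq

lemma negInt_tau_one_sub_two_mul_tau : negInt tau (1 - 2 * tau) := by
  have hl := lt_tau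
  have hr := tau_lt
  have h₁ : negT tau (11 - 7 * tau) = 6 - 4 * tau :=
    negT_tau_eq 1 (by push_cast; linear_combination 7 * tau_sq) (by linarith) (by linarith)
  have h₂ : negT tau (6 - 4 * tau) = 3 - 2 * tau :=
    negT_tau_eq 1 (by push_cast; linear_combination 4 * tau_sq) (by linarith) (by linarith)
  have h₃ : negT tau (3 - 2 * tau) = 1 - tau :=
    negT_tau_eq 1 (by push_cast; linear_combination 2 * tau_sq) (by linarith) (by linarith)
  have h₄ : negT tau (1 - tau) = 0 :=
    negT_tau_eq 1 (by push_cast; linear_combination tau_sq) (by linarith) (by linarith)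
  refine Or.inr ⟨3, 11 - 7 * tau, ?_, ?_, ?_⟩
  · rw [neg_tau_div_tau_add_one, one_div_tau_add_one]
    constructor <;> linarith
  · have h : tau ^ 4 = 3 * tau + 2 := by linear_combination (tau ^ 2 + tau + 2) * tau_sq
    linear_combination (-(11 - 7 * tau)) * h + 21 * tau_sq
  · simp [h₁, h₂, h₃, h₄]

lemma iterate_six_negT_tau : (negT tau)^[6] (40 - 25 * tau) = 1 - tau := by
  have hl := lt_tau
  have hr := tau_lt
  have h₁ : negT tau (40 - 25 * tau) = 24 - 15 * tau :=
    negT_tau_eq 1 (by push_cast; linear_combination 25 * tau_sq) (by linarith) (by linarith)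
  have h₂ : negT tau (24 - 15 * tau) = 14 - 9 * tau :=
    negT_tau_eq 1 (by push_cast; linear_combination 15 * tau_sq) (by linarith) (by linarith)
  have h₃ : negT tau (14 - 9 * tau) = 8 - 5 * tau :=
    negT_tau_eq 1 (by push_cast; linear_combination 9 * tau_sq) (by linarith) (by linarith)
  have h₄ : negT tau (8 - 5 * tau) = 5 - 3 * tau :=
    negT_tau_eq 0 (by push_cast; linear_combination 5 * tau_sq) (by linarith) (by linarith)
  have h₅ : negT tau (5 - 3 * tau) = 3 - 2 * tau :=
    negT_tau_eq 0 (by push_cast; linear_combination 3 * tau_sq) (by linarith) (by linarith)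
  have h₆ : negT tau (3 - 2 * tau) = 1 - tau :=
    negT_tau_eq 1 (by push_cast; linear_combination 2 * tau_sq) (by linarith) (by linarith)
  simp only [Function.iterate_succ_apply, Function.iterate_zero_apply, h₁, h₂, h₃, h₄, h₅, h₆]

lemma mem_Icc_of_neg_tau_pow_mul_eq (j : ℕ) {y : ℝ} (h : (-tau) ^ (j + 6) * y = -5 * tau) :
    y ∈ Set.Icc (-0.46 : ℝ) 0.3 := by
  have hl := lt_tau
  have hr := tau_lt
  induction j generalizing y with
  | zero =>
    rw [eq_of_neg_tau_pow_mul_eq h, zero_add, one_sub_tau_pow_six_mul]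
    constructor <;> linarith
  | succ j ih =>
    obtain ⟨h₁, h₂⟩ := ih (y := -tau * y) (by rw [← h]; ring)
    constructor <;> nlinarith

lemma iterate_negT_tau_of_neg_tau_pow_mul_eq (j : ℕ) {y : ℝ}
    (h : (-tau) ^ (j + 6) * y = -5 * tau) : (negT tau)^[j + 6] y = 1 - tau := by
  have hl := lt_tau
  have hr := tau_lt
  induction j generalizing y with
  | zero =>
    rw [eq_of_neg_tau_pow_mul_eq h, zero_add, one_sub_tau_pow_six_mul, iterate_six_negT_tau]
  | succ j ih =>
    have h' : (-tau) ^ (j + 6) * (-tau * y) = -5 * tau := by rw [← h]; ring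
    obtain ⟨h₁, h₂⟩ := mem_Icc_of_neg_tau_pow_mul_eq j h'
    have hT : negT tau y = -tau * y :=
      negT_tau_eq 0 (by simp) (by linarith) (by linarith)
    rw [show j + 1 + 6 = j + 6 + 1 by ring, Function.iterate_succ_apply, hT]
    exact ih h'

lemma not_negInt_tau_neg_five_mul_tau : ¬ negInt tau (-5 * tau) := by
  have hl := lt_tau
  have hr := tau_lt
  have hs := tau_sq
  rintro (h | ⟨N, y, hy, hz, hT⟩)
  · linarith
  rw [neg_tau_div_tau_add_one, one_div_tau_add_one] at hy
  obtain ⟨hy₁, hy₂⟩ := hy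
  rcases lt_or_ge N 5 with hN | hN
  · have hy := eq_of_neg_tau_pow_mul_eq hz.symm
    interval_cases N
    · have : y = 5 := by linear_combination hy + 5 * hs
      linarith
    · have : y = 5 - 5 * tau := by
        linear_combination hy + (-5 * tau) * one_sub_tau_pow_two + 5 * hs
      linarith
    · have : y = 10 - 5 * tau := by
        linear_combination hy + (1 - tau) * (-5 * tau) * one_sub_tau_pow_two
          + (10 - 5 * tau) * hs
      linarith
    · have : y = 15 - 10 * tau := by
        linear_combination hy + (-5 * tau) * one_sub_tau_pow_four + 15 * hs
      linarith
    · have : y = 25 - 15 * tau := by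
        linear_combination hy + (1 - tau) * (-5 * tau) * one_sub_tau_pow_four
          + (25 - 15 * tau) * hs
      linarith
  · obtain ⟨j, rfl⟩ := Nat.exists_eq_add_of_le' hN
    have h := iterate_negT_tau_of_neg_tau_pow_mul_eq j hz.symm
    rw [hT] at h
    linarith

/-- There exist `x, y ∈ ℤ_{-τ}` with `(-τ)(x·y) ∉ ℤ_{-τ}`, i.e. `L_⊗(-τ) ≥ 2`. -/
theorem L_otimes_neg_tau_ge_two :
    ∃ x y : ℝ, negInt tau x ∧ negInt tau y ∧ ¬ negInt tau ((-tau) * (x * y)) := by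
  refine ⟨1 - 2 * tau, 1 - 2 * tau, negInt_tau_one_sub_two_mul_tau,
    negInt_tau_one_sub_two_mul_tau, ?_⟩
  have h : -tau * ((1 - 2 * tau) * (1 - 2 * tau)) = -5 * tau := by
    linear_combination (-4 * tau) * tau_sq
  rw [h]
  exact not_negInt_tau_neg_five_mul_tau
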